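/- There exists a constant c > 0 such that for all n, m ∈ ℕ with n < 2m and m < n, the number of graphs in 𝒰(n,m) satisfies |𝒰(n,m)| ≤ c · (2/e)^{2m−n} · m^{m+1/2} · n^{n−2m+1/2} · (n−m)^{−(n−m+1/2)} · C(C(n,2), m). (One may take c = e²(π + 2√2)/(√2·π^{3/2}).) -/

import Mathlib

open Filter

/-- A graph has no complex component: for every connected component, the number of
edges joining two vertices of that component is at most the number of its vertices. -/
def NonComplex {n : ℕ} (G : SimpleGraph (Fin n)) : Prop :=
  ∀ c : G.ConnectedComponent,
    {e : Sym2 (Fin n) | e ∈ G.edgeSet ∧ ∀ v ∈ e, v ∈ c.supp}.ncard ≤ c.supp.ncard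

/-- `Ucard n m` is the number of simple graphs on `Fin n` with exactly `m` edges
in which no connected component is complex. -/
noncomputable def Ucard (n m : ℕ) : ℕ :=
  Nat.card {G : SimpleGraph (Fin n) // G.edgeSet.ncard = m ∧ NonComplex G}



section PartOne
open SimpleGraph
set_option linter.unusedSectionVars false
variable {V : Type} [Finite V]

/-- the edges of `G` inside `W` -/
def edgesIn {V : Type} (G : SimpleGraph V) (W : Set V) : Set (Sym2 V) :=
  {e | e ∈ G.edgeSet ∧ ∀ v ∈ e, v ∈ W}

/-- pseudoforests -/
def PF {V : Type} (G : SimpleGraph V) : Prop :=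
  ∀ W : Set V, (edgesIn G W).ncard ≤ W.ncard

lemma edgesIn_eq_image (G : SimpleGraph V) (W : Set V) :
    edgesIn G W = Sym2.map (Subtype.val : W → V) '' (G.induce W).edgeSet := by
  ext e
  induction e using Sym2.ind with
  | _ a b =>
    constructor
    · rintro ⟨h1, h2⟩
      refine ⟨s(⟨a, h2 a (by simp)⟩, ⟨b, h2 b (by simp)⟩), ?_, by simp⟩
      simpa using h1
    · rintro ⟨e, he, h⟩
      induction e using Sym2.ind with
      | _ x y =>
        simp only [Sym2.map_mk] at h
        have he' : G.Adj x y := by simpa using he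
        rw [← h]
        refine ⟨he', ?_⟩
        intro v hv
        simp only [Sym2.mem_iff] at hv
        rcases hv with rfl | rfl
        · exact x.2
        · exact y.2

lemma card_edgesIn (G : SimpleGraph V) (W : Set V) :
    (edgesIn G W).ncard = Nat.card (G.induce W).edgeSet := by
  rw [edgesIn_eq_image, Set.ncard_image_of_injective _ (Sym2.map.injective Subtype.val_injective),
    Nat.card_coe_set_eq]

lemma exists_parent (G : SimpleGraph V) (w v : V) (h : G.Reachable w v) (hne : v ≠ w) :
    ∃ u, G.Adj v u ∧ G.dist v w = G.dist u w + 1 ∧ G.Reachable w u := by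
  obtain ⟨p, hp⟩ := h.symm.exists_walk_length_eq_dist
  cases p with
  | nil => exact absurd rfl hne
  | cons hadj q =>
    rename_i u
    refine ⟨u, hadj, ?_, ⟨q.reverse⟩⟩
    simp only [Walk.length_cons] at hp
    have h1 := G.dist_le q
    have h2 : G.dist v w ≤ G.dist u w + 1 := by
      obtain ⟨q', hq'⟩ := (show G.Reachable u w from ⟨q⟩).exists_walk_length_eq_dist
      have := G.dist_le (Walk.cons hadj q')
      simpa [hq'] using this
    omega

lemma sum_comp_inter (G : SimpleGraph V) [Fintype G.ConnectedComponent] (W : Set V) :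
    ∑ c : G.ConnectedComponent, (W ∩ c.supp).ncard = W.ncard := by
  have h : W = ⋃ c : G.ConnectedComponent, (W ∩ c.supp) := by
    ext v; simp
  conv_rhs => rw [h]
  rw [Set.ncard_iUnion_of_finite (fun _ => Set.toFinite _), finsum_eq_sum_of_fintype]
  intro a b hab
  exact ((pairwise_disjoint_supp_connectedComponent G) hab).mono Set.inter_subset_right
    Set.inter_subset_right

lemma pf_of_comp (G : SimpleGraph V)
    (h : ∀ c : G.ConnectedComponent, (edgesIn G c.supp).ncard ≤ c.supp.ncard) : PF G := by
  classical
  have := Fintype.ofFinite G.ConnectedComponent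
  intro W
  have h1 : edgesIn G W ⊆ ⋃ c : G.ConnectedComponent, edgesIn G (W ∩ c.supp) := by
    intro e
    induction e using Sym2.ind with
    | _ a b =>
      rintro ⟨he, hv⟩
      simp only [Set.mem_iUnion]
      refine ⟨G.connectedComponentMk a, he, ?_⟩
      intro v hv'
      refine ⟨hv v hv', ?_⟩
      have hab : G.Adj a b := he
      simp only [Sym2.mem_iff] at hv'
      rcases hv' with rfl | rfl
      · simp
      · simpa using hab.reachable.symm
  refine (Set.ncard_le_ncard h1 (Set.toFinite _)).trans ?_
  refine (Set.ncard_iUnion_le_of_fintype _).trans ?_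
  rw [← sum_comp_inter G W]
  apply Finset.sum_le_sum
  intro c _
  rcases (W ∩ c.supp).eq_empty_or_nonempty with hE | ⟨w, hwW, hwc⟩
  · rw [hE]
    have : edgesIn G (∅ : Set V) = ∅ := by
      ext e
      induction e using Sym2.ind with
      | _ a b =>
        simp only [edgesIn, Set.mem_ofPred_eq, Set.mem_empty_iff_false, iff_false, not_and]
        intro _ h
        exact h a (by simp)
    simp [this]
  · have hreach : ∀ v ∈ c.supp \ W, ∃ u, G.Adj v u ∧ G.dist v w = G.dist u w + 1 ∧ u ∈ c.supp := by
      rintro v ⟨hv, hvW⟩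
      have hr : G.Reachable w v := c.reachable_of_mem_supp hwc hv
      obtain ⟨u, h1, h2, h3⟩ := exists_parent G w v hr (by rintro rfl; exact hvW hwW)
      refine ⟨u, h1, h2, ?_⟩
      rw [ConnectedComponent.mem_supp_iff] at hv ⊢
      rw [← hv]; exact ConnectedComponent.sound h1.reachable.symm
    choose! p hp using hreach
    have hinj : (c.supp \ W).ncard ≤ (edgesIn G c.supp \ edgesIn G (W ∩ c.supp)).ncard := by
      refine Set.ncard_le_ncard_of_injOn (fun v => s(v, p v)) ?_ ?_ (Set.toFinite _)
      · intro v hv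
        obtain ⟨h1, h2, h3⟩ := hp v hv
        refine ⟨⟨h1, ?_⟩, ?_⟩
        · intro x hx
          simp only [Sym2.mem_iff] at hx
          rcases hx with rfl | rfl
          · exact hv.1
          · exact h3
        · rintro ⟨_, h5⟩
          exact hv.2 (h5 v (by simp)).1
      · intro v hv v' hv' heq
        obtain ⟨h1, h2, h3⟩ := hp v hv
        obtain ⟨h1', h2', h3'⟩ := hp v' hv'
        simp only [Sym2.eq_iff] at heq
        rcases heq with ⟨h, _⟩ | ⟨ha, hb⟩
        · exact h
        · rw [hb] at h2; rw [← ha] at h2'; omega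
    have hsub : edgesIn G (W ∩ c.supp) ⊆ edgesIn G c.supp :=
      fun e he => ⟨he.1, fun v hv => (he.2 v hv).2⟩
    have e1 := Set.ncard_sdiff_add_ncard_of_subset hsub (Set.toFinite _)
    have e2 := Set.ncard_sdiff_add_ncard_of_subset (Set.inter_subset_right : W ∩ c.supp ⊆ c.supp)
      (Set.toFinite _)
    have e3 : c.supp \ (W ∩ c.supp) = c.supp \ W := by ext; simp
    rw [e3] at e2
    have := h c
    omega

lemma PF.comap {U : Type} [Finite U] {G : SimpleGraph V} (h : PF G) (f : U → V)
    (hf : Function.Injective f) : PF (G.comap f) := by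
  intro W
  have h1 := h (f '' W)
  rw [Set.ncard_image_of_injective _ hf] at h1
  refine le_trans ?_ h1
  rw [← Set.ncard_image_of_injective (edgesIn (G.comap f) W) (Sym2.map.injective hf)]
  apply Set.ncard_le_ncard _ (Set.toFinite _)
  rintro _ ⟨e, ⟨he, hW⟩, rfl⟩
  induction e using Sym2.ind with
  | _ a b =>
    refine ⟨by simpa using he, ?_⟩
    intro v hv
    simp only [Sym2.map_mk, Sym2.mem_iff] at hv
    rcases hv with rfl | rfl
    · exact ⟨a, hW a (by simp), rfl⟩
    · exact ⟨b, hW b (by simp), rfl⟩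

lemma PF.induce {G : SimpleGraph V} (h : PF G) (S : Set V) : PF (G.induce S) :=
  h.comap _ Subtype.val_injective

/-- base case: every pseudoforest with `n` edges comes from a function -/
lemma PF.exists_fun {G : SimpleGraph V} (h : PF G) (hc : Nat.card G.edgeSet = Nat.card V) :
    ∃ f : V → V, G.edgeSet = Set.range (fun v => s(v, f v)) := by
  classical
  have := Fintype.ofFinite V
  have hall := (Finset.all_card_le_biUnion_card_iff_exists_injective
    (fun e : G.edgeSet => (e : Sym2 V).toFinset)).1 (by
      intro s
      have h1 := h (↑(s.biUnion (fun e : G.edgeSet => (e : Sym2 V).toFinset)) : Set V)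
      rw [Set.ncard_coe_finset] at h1
      refine le_trans ?_ h1
      rw [← Finset.card_map (Function.Embedding.subtype _), ← Set.ncard_coe_finset]
      apply Set.ncard_le_ncard _ (Set.toFinite _)
      intro e he
      simp only [Finset.coe_map, Set.mem_image, Finset.mem_coe] at he
      obtain ⟨e', he', rfl⟩ := he
      refine ⟨e'.2, ?_⟩
      intro v hv
      simp only [Finset.coe_biUnion, Set.mem_iUnion, Finset.mem_coe]
      exact ⟨e', he', by simpa using hv⟩)
  obtain ⟨φ, hφ, hmem⟩ := hall
  have hbij : Function.Bijective φ := by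
    rw [Nat.bijective_iff_injective_and_card]
    exact ⟨hφ, hc⟩
  let ψ := (Equiv.ofBijective φ hbij).symm
  have hψ : ∀ v, v ∈ (ψ v : Sym2 V) := by
    intro v
    have := hmem (ψ v)
    rw [Sym2.mem_toFinset] at this
    have h2 : φ (ψ v) = v := (Equiv.ofBijective φ hbij).apply_symm_apply v
    rwa [h2] at this
  refine ⟨fun v => Sym2.Mem.other (hψ v), ?_⟩
  have : (fun v => s(v, Sym2.Mem.other (hψ v))) = fun v => (ψ v : Sym2 V) := by
    funext v; exact Sym2.other_spec _
  rw [this]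
  ext e
  constructor
  · intro he
    exact ⟨φ ⟨e, he⟩, by
      have := (Equiv.ofBijective φ hbij).symm_apply_apply ⟨e, he⟩
      exact congrArg Subtype.val this⟩
  · rintro ⟨v, rfl⟩
    exact (ψ v).2

lemma card_PF_zero : Nat.card {G : SimpleGraph V // PF G ∧ Nat.card G.edgeSet = Nat.card V}
    ≤ Nat.card V ^ Nat.card V := by
  rw [← Nat.card_fun]
  choose f hf using fun G : {G : SimpleGraph V // PF G ∧ Nat.card G.edgeSet = Nat.card V} =>
    G.2.1.exists_fun G.2.2
  refine Nat.card_le_card_of_injective f ?_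
  intro G H h
  have h1 := hf G
  rw [h, ← hf H] at h1
  exact Subtype.ext (SimpleGraph.edgeSet_injective h1)

end PartOne


section PartTwo
open SimpleGraph
set_option linter.unusedSectionVars false
variable {V : Type} [Finite V]

lemma ncard_edgesIn_le_sum (G : SimpleGraph V) [Fintype G.ConnectedComponent] :
    ∑ c : G.ConnectedComponent, (edgesIn G c.supp).ncard ≤ Nat.card G.edgeSet := by
  rw [← finsum_eq_sum_of_fintype, ← Set.ncard_iUnion_of_finite (fun _ => Set.toFinite _),
    Nat.card_coe_set_eq]
  · apply Set.ncard_le_ncard _ (Set.toFinite _)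
    intro e he
    simp only [Set.mem_iUnion] at he
    obtain ⟨c, hc⟩ := he
    exact hc.1
  · intro a b hab
    change Disjoint _ _
    rw [Set.disjoint_left]
    intro e
    induction e using Sym2.ind with
    | _ x y =>
      intro h1 h2
      have h3 := h1.2 x (by simp)
      have h4 := h2.2 x (by simp)
      exact hab (h3.symm.trans h4)

lemma le_card_treeComp (G : SimpleGraph V) (r : ℕ) (h : Nat.card G.edgeSet + r = Nat.card V) :
    r ≤ Nat.card {c : G.ConnectedComponent // (G.induce c.supp).IsTree} := by
  classical
  have := Fintype.ofFinite G.ConnectedComponent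
  have h1 := ncard_edgesIn_le_sum G
  have h2 := sum_comp_inter G Set.univ
  have h3 : ∀ c : G.ConnectedComponent, (Set.univ ∩ c.supp).ncard ≤
      (edgesIn G c.supp).ncard + if (G.induce c.supp).IsTree then 1 else 0 := by
    intro c
    rw [Set.univ_inter, card_edgesIn]
    have hcon : (G.induce c.supp).Connected := c.connected_toSimpleGraph
    have h4 := hcon.card_vert_le_card_edgeSet_add_one
    have h5 := isTree_iff_connected_and_card (G := G.induce c.supp)
    rw [Nat.card_coe_set_eq c.supp] at h4 h5
    split_ifs with hT
    · exact h4
    · have : ¬ (Nat.card (G.induce c.supp).edgeSet + 1 = c.supp.ncard) := fun h =>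
        hT (h5.2 ⟨hcon, h⟩)
      omega
  have h4 := Finset.sum_le_sum (fun c (_ : c ∈ Finset.univ) => h3 c)
  rw [h2, Finset.sum_add_distrib, Set.ncard_univ] at h4
  rw [Nat.card_eq_fintype_card, Fintype.card_subtype, Finset.card_filter]
  omega

/-- the union of a graph on `S` and one on the complement -/
def glue (S : Set V) (A : SimpleGraph S) (B : SimpleGraph (Sᶜ : Set V)) : SimpleGraph V :=
  A.map Subtype.val ⊔ B.map Subtype.val

lemma glue_induce (G : SimpleGraph V) (S : Set V) (h : ∀ a b, G.Adj a b → a ∈ S → b ∈ S) :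
    glue S (G.induce S) (G.induce Sᶜ) = G := by
  ext a b
  simp only [glue, sup_adj]
  constructor
  · rintro (⟨-, x, y, h1, rfl, rfl⟩ | ⟨-, x, y, h1, rfl, rfl⟩) <;> simpa using h1
  · intro hab
    by_cases ha : a ∈ S
    · left; exact ⟨hab.ne, ⟨a, ha⟩, ⟨b, h _ _ hab ha⟩, by simpa using hab, rfl, rfl⟩
    · right
      have hb : b ∉ S := fun hb => ha (h _ _ hab.symm hb)
      exact ⟨hab.ne, ⟨a, ha⟩, ⟨b, hb⟩, by simpa using hab, rfl, rfl⟩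

lemma card_edge_split (G : SimpleGraph V) (S : Set V) (h : ∀ a b, G.Adj a b → a ∈ S → b ∈ S) :
    Nat.card G.edgeSet = Nat.card (G.induce S).edgeSet + Nat.card (G.induce Sᶜ).edgeSet := by
  rw [← card_edgesIn, ← card_edgesIn, ← Set.ncard_union_eq, Nat.card_coe_set_eq]
  · congr 1
    ext e
    induction e using Sym2.ind with
    | _ a b =>
      simp only [mem_edgeSet, edgesIn, Set.mem_union, Set.mem_ofPred_eq, Sym2.mem_iff,
        forall_eq_or_imp, forall_eq, Set.mem_compl_iff]
      constructor
      · intro hab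
        have := h a b hab
        have := h b a hab.symm
        tauto
      · tauto
  · rw [Set.disjoint_left]
    intro e
    induction e using Sym2.ind with
    | _ x y =>
      intro h1 h2
      exact h2.2 x (by simp) (h1.2 x (by simp))

/-- number of trees on `V` -/
noncomputable def tc (V : Type) : ℕ := Nat.card {G : SimpleGraph V // G.IsTree}

/-- number of pseudoforests with excess `-r` -/
noncomputable def pc (V : Type) (r : ℕ) : ℕ :=
  Nat.card {G : SimpleGraph V // PF G ∧ Nat.card G.edgeSet + r = Nat.card V}

lemma pc_rec [Fintype (Set V)] (r : ℕ) :
    (r + 1) * pc V (r + 1) ≤ ∑ S : Set V, tc S * pc (Sᶜ : Set V) r := by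
  classical
  have hft : Fintype {G : SimpleGraph V // PF G ∧ Nat.card G.edgeSet + (r + 1) = Nat.card V} :=
    Fintype.ofFinite _
  have h1 : (r + 1) * pc V (r + 1) ≤
      Nat.card (Σ G : {G : SimpleGraph V // PF G ∧ Nat.card G.edgeSet + (r + 1) = Nat.card V},
        {c : G.1.ConnectedComponent // (G.1.induce c.supp).IsTree}) := by
    rw [Nat.card_sigma, mul_comm, pc, Nat.card_eq_fintype_card, ← smul_eq_mul]
    apply Finset.card_nsmul_le_sum
    intro G _
    exact le_card_treeComp G.1 (r + 1) G.2.2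
  refine h1.trans ?_
  have h2 : ∑ S : Set V, tc S * pc (Sᶜ : Set V) r = Nat.card (Σ S : Set V,
      {G : SimpleGraph S // G.IsTree} × {G : SimpleGraph (Sᶜ : Set V) //
        PF G ∧ Nat.card G.edgeSet + r = Nat.card (Sᶜ : Set V)}) := by
    rw [Nat.card_sigma]
    simp only [Nat.card_prod, tc, pc]
  rw [h2]
  have hcl : ∀ (G : SimpleGraph V) (c : G.ConnectedComponent),
      ∀ a b, G.Adj a b → a ∈ c.supp → b ∈ c.supp := by
    intro G c a b hab ha
    rw [ConnectedComponent.mem_supp_iff] at ha ⊢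
    rw [← ha]; exact ConnectedComponent.sound hab.reachable.symm
  let enc : (Σ G : {G : SimpleGraph V // PF G ∧ Nat.card G.edgeSet + (r + 1) = Nat.card V},
        {c : G.1.ConnectedComponent // (G.1.induce c.supp).IsTree}) → (Σ S : Set V,
      {G : SimpleGraph S // G.IsTree} × {G : SimpleGraph (Sᶜ : Set V) //
        PF G ∧ Nat.card G.edgeSet + r = Nat.card (Sᶜ : Set V)}) := fun x =>
    ⟨x.2.1.supp, ⟨x.1.1.induce x.2.1.supp, x.2.2⟩, ⟨x.1.1.induce (x.2.1.supp)ᶜ, x.1.2.1.induce _, by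
      have e1 := card_edge_split x.1.1 x.2.1.supp (hcl _ _)
      have e2 := (isTree_iff_connected_and_card.1 x.2.2).2
      have e3 := x.1.2.2
      have e4 := Set.ncard_add_ncard_compl x.2.1.supp
      rw [← Nat.card_coe_set_eq, ← Nat.card_coe_set_eq] at e4
      omega⟩⟩
  let dec : (Σ S : Set V,
      {G : SimpleGraph S // G.IsTree} × {G : SimpleGraph (Sᶜ : Set V) //
        PF G ∧ Nat.card G.edgeSet + r = Nat.card (Sᶜ : Set V)}) → SimpleGraph V × Set V :=
    fun y => (glue y.1 y.2.1.1 y.2.2.1, y.1)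
  have hde : ∀ x, dec (enc x) = (x.1.1, x.2.1.supp) := by
    intro x
    simp only [enc, dec, glue_induce x.1.1 x.2.1.supp (hcl _ _)]
  refine Nat.card_le_card_of_injective enc ?_
  rintro ⟨⟨G, hG⟩, ⟨c, hc⟩⟩ ⟨⟨H, hH⟩, ⟨d, hd⟩⟩ heq
  have h3 := congrArg dec heq
  rw [hde, hde] at h3
  simp only [Prod.mk.injEq] at h3
  obtain ⟨rfl, h4⟩ := h3
  have : c = d := ConnectedComponent.supp_injective h4
  subst this
  rfl

lemma tc_rec [Fintype (Set V)] :
    2 * (Nat.card V - 1) * tc V ≤ ∑ S : Set V, tc S * tc (Sᶜ : Set V) *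
      (Nat.card S * Nat.card (Sᶜ : Set V)) := by
  classical
  have := Fintype.ofFinite V
  have hft : Fintype {G : SimpleGraph V // G.IsTree} := Fintype.ofFinite _
  have h1 : 2 * (Nat.card V - 1) * tc V = Nat.card (Σ G : {G : SimpleGraph V // G.IsTree}, G.1.Dart) := by
    rw [Nat.card_sigma, mul_comm, tc, Nat.card_eq_fintype_card (α := {G : SimpleGraph V // G.IsTree})]
    rw [Finset.sum_const_nat (m := 2 * (Nat.card V - 1))]
    · rfl
    · intro G _
      rw [Nat.card_eq_fintype_card, G.1.dart_card_eq_twice_card_edges]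
      have := G.2.card_edgeFinset
      rw [Nat.card_eq_fintype_card (α := V)]
      omega
  rw [h1]
  have h2 : ∑ S : Set V, tc S * tc (Sᶜ : Set V) * (Nat.card S * Nat.card (Sᶜ : Set V)) =
    Nat.card (Σ S : Set V, ({G : SimpleGraph S // G.IsTree} ×
      {G : SimpleGraph (Sᶜ : Set V) // G.IsTree}) × (S × (Sᶜ : Set V))) := by
    rw [Nat.card_sigma]
    simp only [Nat.card_prod, tc]
  rw [h2]
  have key : ∀ (G : SimpleGraph V) (hG : G.IsTree) (d : G.Dart), ∃ S : Set V,
      d.fst ∈ S ∧ d.snd ∈ Sᶜ ∧ (G.induce S).IsTree ∧ (G.induce Sᶜ).IsTree ∧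
      ∀ a b, G.Adj a b → a ∈ S → b ∉ S → s(a, b) = s(d.fst, d.snd) := by
    rintro G hG ⟨⟨u, v⟩, huv⟩
    simp only at huv ⊢
    have hbr : ¬ (G.deleteEdges {s(u, v)}).Reachable u v :=
      isAcyclic_iff_forall_adj_isBridge.1 hG.2 huv
    set H := G.deleteEdges {s(u, v)} with hH
    have hHa : ∀ a b, G.Adj a b → s(a, b) ≠ s(u, v) → H.Adj a b := by
      intro a b hab hne
      rw [hH, deleteEdges_adj]
      exact ⟨hab, by simpa using hne⟩
    have hdich : ∀ x, H.Reachable u x ∨ H.Reachable v x := by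
      intro x
      have : ∀ (a : V) (p : G.Walk a x), (H.Reachable u a ∨ H.Reachable v a) →
          (H.Reachable u x ∨ H.Reachable v x) := by
        intro a p
        induction p with
        | nil => exact id
        | cons hab q ih =>
          rename_i a b c
          intro h
          apply ih
          by_cases he : s(a, b) = s(u, v)
          · rw [Sym2.eq_iff] at he
            rcases he with ⟨rfl, rfl⟩ | ⟨rfl, rfl⟩
            · right; exact Reachable.refl _
            · left; exact Reachable.refl _
          · have := (hHa a b hab he).reachable
            exact h.imp (fun h => h.trans this) (fun h => h.trans this)
      obtain ⟨p⟩ := hG.1.preconnected u x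
      exact this u p (Or.inl (Reachable.refl _))
    have hS : (H.connectedComponentMk u).suppᶜ = (H.connectedComponentMk v).supp := by
      ext x
      simp only [Set.mem_compl_iff, ConnectedComponent.mem_supp_iff, ConnectedComponent.eq]
      constructor
      · intro h
        exact ((hdich x).resolve_left (fun h' => h h'.symm)).symm
      · intro h h'
        exact hbr (h'.symm.trans h)
    have hmono : ∀ S : Set V, (H.induce S).Connected → (G.induce S).IsTree := by
      intro S h
      refine ⟨h.mono ?_, hG.2.induce S⟩
      exact SimpleGraph.comap_monotone _ (deleteEdges_le _)
    refine ⟨(H.connectedComponentMk u).supp, by simp, ?_, ?_, ?_, ?_⟩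
    · rw [hS]; simp
    · exact hmono _ (ConnectedComponent.connected_toSimpleGraph _)
    · rw [hS]; exact hmono _ (ConnectedComponent.connected_toSimpleGraph _)
    · intro a b hab ha hb
      by_contra hne
      apply hb
      rw [ConnectedComponent.mem_supp_iff, ConnectedComponent.eq] at ha ⊢
      exact (hHa a b hab hne).symm.reachable.trans ha
  choose S hS1 hS2 hS3 hS4 hS5 using key
  let enc : (Σ G : {G : SimpleGraph V // G.IsTree}, G.1.Dart) →
      (Σ S : Set V, ({G : SimpleGraph S // G.IsTree} ×
      {G : SimpleGraph (Sᶜ : Set V) // G.IsTree}) × (S × (Sᶜ : Set V))) := fun x =>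
    ⟨S x.1.1 x.1.2 x.2, (⟨x.1.1.induce _, hS3 _ _ _⟩, ⟨x.1.1.induce _, hS4 _ _ _⟩),
      (⟨x.2.fst, hS1 _ _ _⟩, ⟨x.2.snd, hS2 _ _ _⟩)⟩
  let dec : (Σ S : Set V, ({G : SimpleGraph S // G.IsTree} ×
      {G : SimpleGraph (Sᶜ : Set V) // G.IsTree}) × (S × (Sᶜ : Set V))) →
      SimpleGraph V × V × V := fun y =>
    (glue y.1 y.2.1.1.1 y.2.1.2.1 ⊔ SimpleGraph.edge (y.2.2.1 : V) (y.2.2.2 : V),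
      y.2.2.1, y.2.2.2)
  have hde : ∀ x, dec (enc x) = (x.1.1, x.2.fst, x.2.snd) := by
    rintro ⟨⟨G, hG⟩, d⟩
    simp only [enc, dec, Prod.mk.injEq, and_true]
    ext a b
    simp only [glue, sup_adj, edge_adj]
    constructor
    · rintro ((⟨-, x, y, h1, rfl, rfl⟩ | ⟨-, x, y, h1, rfl, rfl⟩) | ⟨⟨rfl, rfl⟩ | ⟨rfl, rfl⟩, hne⟩)
      · simpa using h1
      · simpa using h1
      · exact d.adj
      · exact d.adj.symm
    · intro hab
      by_cases ha : a ∈ S G hG d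
      · by_cases hb : b ∈ S G hG d
        · left; left; exact ⟨hab.ne, ⟨a, ha⟩, ⟨b, hb⟩, by simpa using hab, rfl, rfl⟩
        · right
          have := hS5 G hG d a b hab ha hb
          rw [Sym2.eq_iff] at this
          have hne := hab.ne
          grind
      · by_cases hb : b ∈ S G hG d
        · right
          have := hS5 G hG d b a hab.symm hb ha
          rw [Sym2.eq_iff] at this
          have hne := hab.ne
          grind
        · left; right; exact ⟨hab.ne, ⟨a, ha⟩, ⟨b, hb⟩, by simpa using hab, rfl, rfl⟩
  refine Nat.card_le_card_of_injective enc ?_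
  rintro ⟨⟨G, hG⟩, d⟩ ⟨⟨H, hH⟩, d'⟩ heq
  have h3 := congrArg dec heq
  rw [hde, hde] at h3
  simp only [Prod.mk.injEq] at h3
  obtain ⟨rfl, h4, h5⟩ := h3
  have : d = d' := by
    apply Dart.ext
    exact Prod.ext h4 h5
  subst this
  rfl

end PartTwo


section PartThree
open SimpleGraph
set_option linter.unusedSectionVars false

lemma tc_le {V W : Type} [Finite V] [Finite W] (e : V ≃ W) : tc V ≤ tc W := by
  unfold tc
  refine Nat.card_le_card_of_injective
    (fun G => ⟨G.1.comap e.symm, ((Iso.comap e.symm G.1).isTree_iff).2 G.2⟩) ?_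
  intro G H h
  simp only [Subtype.mk.injEq] at h
  apply Subtype.ext
  have := congrArg (fun K : SimpleGraph W => K.comap e) h
  simpa [SimpleGraph.comap_comap] using this

lemma tc_eq {V : Type} [Finite V] : tc V = tc (Fin (Nat.card V)) :=
  le_antisymm (tc_le (Finite.equivFin V)) (tc_le (Finite.equivFin V).symm)

lemma pc_le {V W : Type} [Finite V] [Finite W] (e : V ≃ W) (r : ℕ) : pc V r ≤ pc W r := by
  unfold pc
  refine Nat.card_le_card_of_injective
    (fun G => ⟨G.1.comap e.symm, G.2.1.comap _ e.symm.injective, by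
      rw [Nat.card_congr (Iso.comap e.symm G.1).mapEdgeSet, G.2.2, Nat.card_congr e]⟩) ?_
  intro G H h
  simp only [Subtype.mk.injEq] at h
  apply Subtype.ext
  have := congrArg (fun K : SimpleGraph W => K.comap e) h
  simpa [SimpleGraph.comap_comap] using this

lemma pc_eq {V : Type} [Finite V] (r : ℕ) : pc V r = pc (Fin (Nat.card V)) r :=
  le_antisymm (pc_le (Finite.equivFin V) r) (pc_le (Finite.equivFin V).symm r)

lemma sum_set_card (n : ℕ) [Fintype (Set (Fin n))] (f : ℕ → ℕ → ℕ) :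
    ∑ S : Set (Fin n), f (Nat.card S) (Nat.card (Sᶜ : Set (Fin n))) =
      ∑ k ∈ Finset.range (n + 1), n.choose k * f k (n - k) := by
  have h := Finset.sum_powerset_apply_card (fun k => f k (n - k))
    (x := (Finset.univ : Finset (Fin n)))
  simp only [Finset.card_univ, Fintype.card_fin, smul_eq_mul, Finset.powerset_univ] at h
  rw [← h]
  symm
  refine Fintype.sum_equiv (Fintype.finsetEquivSet) _ _ ?_
  intro s
  have h1 : Nat.card (↑(Fintype.finsetEquivSet s) : Set (Fin n)) = s.card := by
    simp [Nat.card_coe_set_eq]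
  have h2 := Set.ncard_add_ncard_compl (Fintype.finsetEquivSet s)
  rw [← Nat.card_coe_set_eq, ← Nat.card_coe_set_eq, h1] at h2
  simp only [Nat.card_eq_fintype_card (α := Fin n), Fintype.card_fin] at h2
  rw [h1]
  congr 1
  omega

lemma P_rec (n r : ℕ) : (r + 1) * pc (Fin n) (r + 1) ≤
    ∑ k ∈ Finset.range (n + 1), n.choose k * (tc (Fin k) * pc (Fin (n - k)) r) := by
  classical
  have := Fintype.ofFinite (Set (Fin n))
  refine (pc_rec r).trans (le_of_eq ?_)
  rw [← sum_set_card n (fun a b => tc (Fin a) * pc (Fin b) r)]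
  refine Finset.sum_congr rfl fun S _ => ?_
  rw [tc_eq, pc_eq]

lemma T_rec (n : ℕ) : 2 * (n - 1) * tc (Fin n) ≤
    ∑ k ∈ Finset.range (n + 1), n.choose k *
      (tc (Fin k) * tc (Fin (n - k)) * (k * (n - k))) := by
  classical
  have := Fintype.ofFinite (Set (Fin n))
  have h := tc_rec (V := Fin n)
  simp only [Nat.card_eq_fintype_card (α := Fin n), Fintype.card_fin] at h
  refine h.trans (le_of_eq ?_)
  rw [← sum_set_card n (fun a b => tc (Fin a) * tc (Fin b) * (a * b))]
  refine Finset.sum_congr rfl fun S _ => ?_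
  rw [tc_eq (V := S), tc_eq (V := (Sᶜ : Set (Fin n)))]

lemma tc_zero : tc (Fin 0) = 0 := by
  unfold tc
  have : IsEmpty {G : SimpleGraph (Fin 0) // G.IsTree} :=
    ⟨fun G => by obtain ⟨x⟩ := G.2.1.nonempty; exact x.elim0⟩
  exact Nat.card_of_isEmpty

lemma tc_one : tc (Fin 1) ≤ 1 := by
  unfold tc
  exact Finite.card_le_one_iff_subsingleton.2 inferInstance

lemma pc_zero (n : ℕ) : pc (Fin n) 0 ≤ n ^ n := by
  have := card_PF_zero (V := Fin n)
  simpa [pc] using this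

lemma Ucard_le (n m : ℕ) (h : m ≤ n) : Ucard n m ≤ pc (Fin n) (n - m) := by
  unfold Ucard pc
  refine Nat.card_le_card_of_injective (fun G => ⟨G.1, pf_of_comp G.1 G.2.2, ?_⟩) ?_
  · have := G.2.1
    rw [Nat.card_coe_set_eq, this]
    simp only [Nat.card_eq_fintype_card, Fintype.card_fin]
    omega
  · intro G H hGH
    simpa [Subtype.ext_iff] using hGH

end PartThree


section PartFour
open Polynomial

lemma sum_antidiag_le (N : ℕ) (f : ℕ × ℕ → ℝ) (hf : ∀ p, 0 ≤ f p) :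
    ∑ k ∈ Finset.range N, ∑ p ∈ Finset.HasAntidiagonal.antidiagonal k, f p ≤
      ∑ p ∈ Finset.range N ×ˢ Finset.range N, f p := by
  rw [← Finset.sum_biUnion]
  · apply Finset.sum_le_sum_of_subset_of_nonneg
    · intro p hp
      simp only [Finset.mem_biUnion, Finset.mem_range, Finset.HasAntidiagonal.mem_antidiagonal] at hp
      obtain ⟨k, hk, h⟩ := hp
      simp only [Finset.mem_product, Finset.mem_range]
      omega
    · intro p _ _; exact hf p
  · intro a _ b _ hab
    change Disjoint _ _
    rw [Finset.disjoint_left]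
    intro p h1 h2
    simp only [Finset.HasAntidiagonal.mem_antidiagonal] at h1 h2
    exact hab (h1.symm.trans h2)

/-- analytic core -/
lemma tree_sum_le (t : ℕ → ℝ) (ht : ∀ k, 0 ≤ t k) (h1 : t 1 ≤ 1)
    (hrec : ∀ n : ℕ, 1 ≤ n → 2 * ((n : ℝ) - 1) * t n ≤
      ∑ p ∈ Finset.HasAntidiagonal.antidiagonal n, (p.1 * t p.1) * (p.2 * t p.2)) (N : ℕ) :
    ∑ k ∈ Finset.range N, t (k + 1) * Real.exp (-1) ^ (k + 1) ≤ 1 / 2 := by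
  set Q : ℝ[X] := ∑ k ∈ Finset.range N, C (((k : ℝ) + 1) * t (k + 1)) * X ^ k with hQ
  set P : ℝ[X] := ∑ k ∈ Finset.range N, C (t (k + 1)) * X ^ (k + 1) with hP
  have hPQ : derivative P = Q := by
    simp only [hP, hQ, derivative_sum, derivative_C_mul_X_pow]
    refine Finset.sum_congr rfl fun k _ => ?_
    push_cast
    rw [mul_comm (t (k + 1))]
  have hS : ∀ x, x * Q.eval x = ∑ k ∈ Finset.range (N + 1), (k * t k) * x ^ k := by
    intro x
    rw [Finset.sum_range_succ', hQ, eval_finsetSum, Finset.mul_sum]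
    simp only [eval_mul, eval_C, eval_pow, eval_X, Nat.cast_zero, zero_mul, add_zero]
    refine Finset.sum_congr rfl fun k _ => ?_
    push_cast; ring
  have hD : ∀ x, x * (Q.eval x + x * (derivative Q).eval x) =
      ∑ k ∈ Finset.range (N + 1), (k * (k * t k)) * x ^ k := by
    intro x
    rw [Finset.sum_range_succ', hQ]
    simp only [derivative_sum, derivative_C_mul_X_pow, eval_finsetSum, eval_mul, eval_C, eval_pow,
      eval_X, Nat.cast_zero, zero_mul, add_zero]
    rw [Finset.mul_sum, ← Finset.sum_add_distrib, Finset.mul_sum]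
    refine Finset.sum_congr rfl fun k _ => ?_
    rcases k with _ | k
    · simp [mul_comm]
    · push_cast
      ring
  have hQ0 : ∀ x, 0 ≤ x → 0 ≤ Q.eval x := by
    intro x hx
    rw [hQ, eval_finsetSum]
    refine Finset.sum_nonneg fun k _ => ?_
    have := ht (k + 1)
    simp only [eval_mul, eval_C, eval_pow, eval_X]
    positivity
  -- the differential inequality
  have hineq : ∀ x, 0 ≤ x → x ^ 2 * (derivative Q).eval x ≤
      (x * Q.eval x) * (x * (Q.eval x + x * (derivative Q).eval x)) := by
    intro x hx
    have e1 : x ^ 2 * (derivative Q).eval x =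
        x * (Q.eval x + x * (derivative Q).eval x) - x * Q.eval x := by ring
    rw [e1, hD, hS, Finset.sum_mul_sum, ← Finset.sum_product',
      ← Finset.sum_sub_distrib]
    refine le_trans ?_ (sum_antidiag_le (N + 1) _ ?_)
    · refine Finset.sum_le_sum fun n _ => ?_
      rcases Nat.eq_zero_or_pos n with rfl | hn
      · simp
      · have h2 := hrec n hn
        have e2 : ∑ p ∈ Finset.HasAntidiagonal.antidiagonal n,
            (p.1 * t p.1) * x ^ p.1 * ((p.2 * (p.2 * t p.2)) * x ^ p.2) =
            (∑ p ∈ Finset.HasAntidiagonal.antidiagonal n, (p.1 * t p.1) * (p.2 * t p.2) * p.2) * x ^ n := by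
          rw [Finset.sum_mul]
          refine Finset.sum_congr rfl fun p hp => ?_
          rw [← Finset.HasAntidiagonal.mem_antidiagonal.1 hp, pow_add]
          ring
        rw [e2]
        have e3 : ∑ p ∈ Finset.HasAntidiagonal.antidiagonal n, ((p.1 : ℝ) * t p.1) * (p.2 * t p.2) * p.2 =
            ∑ p ∈ Finset.HasAntidiagonal.antidiagonal n, ((p.1 : ℝ) * t p.1) * (p.2 * t p.2) * p.1 := by
          rw [← Finset.sum_equiv (Equiv.prodComm ℕ ℕ) (s := Finset.HasAntidiagonal.antidiagonal n)]
          · intro p; simp [add_comm]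
          · intro p hp
            simp only [Equiv.prodComm_apply, Prod.fst_swap, Prod.snd_swap]
            ring
        have e4 : ∑ p ∈ Finset.HasAntidiagonal.antidiagonal n, ((p.1 : ℝ) * t p.1) * (p.2 * t p.2) * p.2 +
            ∑ p ∈ Finset.HasAntidiagonal.antidiagonal n, ((p.1 : ℝ) * t p.1) * (p.2 * t p.2) * p.1 =
            n * ∑ p ∈ Finset.HasAntidiagonal.antidiagonal n, ((p.1 : ℝ) * t p.1) * (p.2 * t p.2) := by
          rw [← Finset.sum_add_distrib, Finset.mul_sum]
          refine Finset.sum_congr rfl fun p hp => ?_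
          rw [← Finset.HasAntidiagonal.mem_antidiagonal.1 hp]
          push_cast; ring
        have e5 : (n : ℝ) * (2 * ((n : ℝ) - 1) * t n) ≤
          n * ∑ p ∈ Finset.HasAntidiagonal.antidiagonal n, ((p.1 : ℝ) * t p.1) * (p.2 * t p.2) := by gcongr
        rw [← sub_mul]
        apply mul_le_mul_of_nonneg_right _ (by positivity)
        nlinarith
    · intro p
      have := ht p.1
      have := ht p.2
      positivity
  have hq : ∀ x, 0 ≤ x → (x * Q.eval x) * Real.exp (-(x * Q.eval x)) ≤ x := by
    have hder : ∀ x : ℝ, HasDerivAt (fun x => Q.eval x * Real.exp (-(x * Q.eval x)))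
        ((derivative Q).eval x * Real.exp (-(x * Q.eval x)) + Q.eval x *
          (Real.exp (-(x * Q.eval x)) * (-(1 * Q.eval x + x * (derivative Q).eval x)))) x := by
      intro x
      exact (Q.hasDerivAt x).mul (((hasDerivAt_id x).mul (Q.hasDerivAt x)).neg.exp)
    have hanti : AntitoneOn (fun x => Q.eval x * Real.exp (-(x * Q.eval x))) (Set.Ici 0) := by
      apply antitoneOn_of_deriv_nonpos (convex_Ici 0)
      · exact fun x _ => (hder x).continuousAt.continuousWithinAt
      · exact fun x _ => (hder x).differentiableAt.differentiableWithinAt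
      · intro x hx
        simp only [interior_Ici, Set.mem_Ioi] at hx
        rw [(hder x).deriv]
        have h3 := hineq x hx.le
        have h4 : (derivative Q).eval x - Q.eval x * (Q.eval x + x * (derivative Q).eval x) ≤ 0 := by
          have : 0 < x ^ 2 := by positivity
          by_contra hcon
          push Not at hcon
          nlinarith [mul_pos this hcon]
        have h5 := mul_nonpos_of_nonneg_of_nonpos (Real.exp_pos (-(x * Q.eval x))).le h4
        linarith [h5]
    intro x hx
    have h3 := hanti (Set.mem_Ici.2 le_rfl) (Set.mem_Ici.2 hx) hx
    have h4 : Q.eval 0 ≤ 1 := by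
      rw [hQ, eval_finsetSum]
      rcases N with _ | N
      · simp
      · rw [Finset.sum_range_succ']
        simpa using h1
    simp only [zero_mul, neg_zero, Real.exp_zero, mul_one] at h3
    calc _ = x * (Q.eval x * Real.exp (-(x * Q.eval x))) := by ring
      _ ≤ x * 1 := by gcongr; linarith
      _ = x := mul_one x
  have hlt1 : ∀ x, 0 ≤ x → x < Real.exp (-1) → x * Q.eval x < 1 := by
    intro x hx hxe
    by_contra hcon
    push Not at hcon
    have hcont : ContinuousOn (fun x => x * Q.eval x) (Set.Icc 0 x) := by fun_prop
    have := intermediate_value_Icc hx hcont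
    obtain ⟨y, hy, hy1⟩ := this (show (1 : ℝ) ∈ _ from ⟨by simp, hcon⟩)
    have h3 := hq y hy.1
    simp only at hy1
    rw [hy1] at h3
    linarith [hy.2]
  have hmono : StrictMonoOn (fun y : ℝ => y * Real.exp (-y)) (Set.Icc 0 1) := by
    apply strictMonoOn_of_deriv_pos (convex_Icc 0 1) (by fun_prop)
    intro x hx
    simp only [interior_Icc, Set.mem_Ioo] at hx
    have : HasDerivAt (fun y : ℝ => y * Real.exp (-y))
        (1 * Real.exp (-x) + x * (Real.exp (-x) * (-1))) x :=
      (hasDerivAt_id x).mul ((hasDerivAt_id x).neg.exp)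
    rw [this.deriv]
    nlinarith [Real.exp_pos (-x)]
  have hle : ∀ u, 0 < u → u < 1 → Q.eval (u * Real.exp (-u)) * Real.exp (-u) ≤ 1 := by
    intro u hu hu1
    have hx : u * Real.exp (-u) < Real.exp (-1) := by
      have := hmono (show u ∈ Set.Icc (0 : ℝ) 1 from ⟨hu.le, hu1.le⟩)
        (show (1 : ℝ) ∈ Set.Icc (0 : ℝ) 1 from ⟨zero_le_one, le_rfl⟩) hu1
      simpa using this
    have hx0 : 0 ≤ u * Real.exp (-u) := by positivity
    have h3 := hlt1 _ hx0 hx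
    have h4 := hq _ hx0
    have h5 := hQ0 _ hx0
    have h6 : u * Real.exp (-u) * Q.eval (u * Real.exp (-u)) ≤ u := by
      exact (hmono.le_iff_le ⟨by positivity, h3.le⟩ ⟨hu.le, hu1.le⟩).1 h4
    have h7 : u * (Q.eval (u * Real.exp (-u)) * Real.exp (-u)) ≤ u * 1 := by linarith
    exact le_of_mul_le_mul_left h7 hu
  have hgder : ∀ u : ℝ, HasDerivAt (fun u => P.eval (u * Real.exp (-u)) - u + u ^ 2 / 2)
      (Q.eval (u * Real.exp (-u)) * (1 * Real.exp (-u) + u * (Real.exp (-u) * (-1))) - 1 +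
        ((2 : ℕ) : ℝ) * u ^ (2 - 1) / 2) u := by
    intro u
    have h3 : HasDerivAt (fun y : ℝ => y * Real.exp (-y))
        (1 * Real.exp (-u) + u * (Real.exp (-u) * (-1))) u :=
      (hasDerivAt_id u).mul ((hasDerivAt_id u).neg.exp)
    have h4 := P.hasDerivAt (u * Real.exp (-u))
    rw [hPQ] at h4
    exact ((h4.comp u h3).sub (hasDerivAt_id u)).add ((hasDerivAt_pow 2 u).div_const 2)
  have hganti : AntitoneOn (fun u => P.eval (u * Real.exp (-u)) - u + u ^ 2 / 2)
      (Set.Icc 0 1) := by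
    apply antitoneOn_of_deriv_nonpos (convex_Icc 0 1)
    · exact fun x _ => (hgder x).continuousAt.continuousWithinAt
    · exact fun x _ => (hgder x).differentiableAt.differentiableWithinAt
    · intro u hu
      simp only [interior_Icc, Set.mem_Ioo] at hu
      rw [(hgder u).deriv]
      have := hle u hu.1 hu.2
      have h5 : (1 - u) * (Q.eval (u * Real.exp (-u)) * Real.exp (-u) - 1) ≤ 0 :=
        mul_nonpos_of_nonneg_of_nonpos (by linarith [hu.2]) (by linarith)
      norm_num
      linarith
  have hfin := hganti (show (0 : ℝ) ∈ Set.Icc (0 : ℝ) 1 from ⟨le_rfl, zero_le_one⟩)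
    (show (1 : ℝ) ∈ Set.Icc (0 : ℝ) 1 from ⟨zero_le_one, le_rfl⟩) zero_le_one
  have hP0 : P.eval 0 = 0 := by
    rw [hP, eval_finsetSum]
    exact Finset.sum_eq_zero fun k _ => by simp
  have hP1 : P.eval (Real.exp (-1)) =
      ∑ k ∈ Finset.range N, t (k + 1) * Real.exp (-1) ^ (k + 1) := by
    rw [hP, eval_finsetSum]
    exact Finset.sum_congr rfl fun k _ => by simp
  simp only [one_mul, zero_mul, hP0, hP1] at hfin
  linarith

end PartFour


section PartFive

lemma tree_sum (n : ℕ) :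
    ∑ k ∈ Finset.range (n + 1), (tc (Fin k) : ℝ) / k.factorial * Real.exp (-1) ^ k ≤ 1 / 2 := by
  rw [Finset.sum_range_succ', tc_zero]
  simp only [Nat.cast_zero, zero_div, zero_mul, add_zero]
  refine tree_sum_le (fun k => (tc (Fin k) : ℝ) / k.factorial) (fun k => by positivity) ?_ ?_ n
  · simpa using tc_one
  · intro n hn
    have h := T_rec n
    have h' : ((2 * (n - 1) * tc (Fin n) : ℕ) : ℝ) ≤ ((∑ k ∈ Finset.range (n + 1), n.choose k *
      (tc (Fin k) * tc (Fin (n - k)) * (k * (n - k))) : ℕ) : ℝ) := by exact_mod_cast h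
    rw [Finset.Nat.sum_antidiagonal_eq_sum_range_succ
      (fun i j => ((i : ℝ) * ((tc (Fin i) : ℝ) / i.factorial)) *
        (j * ((tc (Fin j) : ℝ) / j.factorial)))]
    have hf : (0 : ℝ) < n.factorial := by positivity
    have e1 : (∑ k ∈ Finset.range n.succ, ((k : ℝ) * ((tc (Fin k) : ℝ) / k.factorial)) *
        (((n - k : ℕ) : ℝ) * ((tc (Fin (n - k)) : ℝ) / (n - k).factorial))) =
        ((∑ k ∈ Finset.range (n + 1), n.choose k *
      (tc (Fin k) * tc (Fin (n - k)) * (k * (n - k))) : ℕ) : ℝ) / n.factorial := by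
      rw [Nat.cast_sum, Finset.sum_div]
      refine Finset.sum_congr rfl fun k hk => ?_
      have hk' : k ≤ n := by simpa [Nat.lt_succ_iff] using hk
      push_cast [Nat.cast_choose ℝ hk']
      have h1 : (k.factorial : ℝ) ≠ 0 := by positivity
      have h2 : ((n - k).factorial : ℝ) ≠ 0 := by positivity
      field_simp
    rw [e1, le_div_iff₀ hf]
    refine le_trans (le_of_eq ?_) h'
    push_cast [Nat.cast_sub hn]
    field_simp

lemma P_bound (r : ℕ) : ∀ n : ℕ, (pc (Fin n) r : ℝ) ≤
    n.factorial * Real.exp 1 ^ n * ((1 / 2) ^ r / r.factorial) := by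
  induction r with
  | zero =>
    intro n
    have h1 : (pc (Fin n) 0 : ℝ) ≤ (n : ℝ) ^ n := by exact_mod_cast pc_zero n
    have h2 := Real.pow_div_factorial_le_exp (x := n) (by positivity) n
    rw [div_le_iff₀ (by positivity)] at h2
    rw [← Real.exp_nat_mul, mul_one]
    simp only [pow_zero, Nat.factorial_zero, Nat.cast_one, div_one, mul_one]
    linarith
  | succ r ih =>
    intro n
    have h := P_rec n r
    have h' : (((r + 1) * pc (Fin n) (r + 1) : ℕ) : ℝ) ≤ ((∑ k ∈ Finset.range (n + 1),
      n.choose k * (tc (Fin k) * pc (Fin (n - k)) r) : ℕ) : ℝ) := by exact_mod_cast h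
    have h2 : ((∑ k ∈ Finset.range (n + 1),
        n.choose k * (tc (Fin k) * pc (Fin (n - k)) r) : ℕ) : ℝ) ≤
        ∑ k ∈ Finset.range (n + 1), (n.factorial * Real.exp 1 ^ n * ((1 / 2) ^ r / r.factorial)) *
          ((tc (Fin k) : ℝ) / k.factorial * Real.exp (-1) ^ k) := by
      rw [Nat.cast_sum]
      refine Finset.sum_le_sum fun k hk => ?_
      have hk' : k ≤ n := by simpa [Nat.lt_succ_iff] using hk
      push_cast [Nat.cast_choose ℝ hk']
      have e1 : Real.exp 1 ^ n * Real.exp (-1) ^ k = Real.exp 1 ^ (n - k) := by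
        rw [← Real.exp_nat_mul, ← Real.exp_nat_mul, ← Real.exp_nat_mul, ← Real.exp_add]
        push_cast [Nat.cast_sub hk']
        ring_nf
      have h1 : (k.factorial : ℝ) ≠ 0 := by positivity
      have h2 : ((n - k).factorial : ℝ) ≠ 0 := by positivity
      calc _ ≤ (n.factorial : ℝ) / (k.factorial * (n - k).factorial) * (tc (Fin k) *
            ((n - k).factorial * Real.exp 1 ^ (n - k) * ((1 / 2) ^ r / r.factorial))) := by
            gcongr
            exact ih (n - k)
        _ = _ := by
            rw [← e1]
            field_simp
    rw [← Finset.mul_sum] at h2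
    have h3 := tree_sum n
    have h4 : (n.factorial * Real.exp 1 ^ n * ((1 / 2) ^ r / r.factorial)) *
        ∑ k ∈ Finset.range (n + 1), (tc (Fin k) : ℝ) / k.factorial * Real.exp (-1) ^ k ≤
        (n.factorial * Real.exp 1 ^ n * ((1 / 2) ^ r / r.factorial)) * (1 / 2) := by gcongr
    have h5 := h'.trans (h2.trans h4)
    rw [Nat.factorial_succ]
    push_cast at h5 ⊢
    have hr : (0 : ℝ) < (r : ℝ) + 1 := by positivity
    have e : (n.factorial : ℝ) * Real.exp 1 ^ n * ((1 / 2) ^ (r + 1) / (((r : ℝ) + 1) * r.factorial))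
      = (n.factorial * Real.exp 1 ^ n * ((1 / 2) ^ r / r.factorial)) * (1 / 2) / ((r : ℝ) + 1) := by
      rw [pow_succ]; field_simp
    rw [e, le_div_iff₀ hr]
    linarith

lemma fact_upper (n : ℕ) (hn : 1 ≤ n) :
    (n.factorial : ℝ) ≤ Real.exp 1 * √n * (n ^ n / Real.exp 1 ^ n) := by
  obtain ⟨k, rfl⟩ : ∃ k, n = k + 1 := ⟨n - 1, by omega⟩
  have h := Stirling.stirlingSeq'_antitone (Nat.zero_le k)
  simp only [Function.comp, Nat.succ_eq_add_one, zero_add] at h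
  rw [Stirling.stirlingSeq_one, Stirling.stirlingSeq, div_le_iff₀ (by positivity)] at h
  refine h.trans (le_of_eq ?_)
  rw [Real.sqrt_mul (by norm_num), div_pow]
  have : √(2 : ℝ) ≠ 0 := by positivity
  field_simp

lemma fact_lower (n : ℕ) :
    √n * (n ^ n / Real.exp 1 ^ n) ≤ (n.factorial : ℝ) := by
  refine le_trans ?_ (Stirling.le_factorial_stirling n)
  rw [div_pow]
  gcongr
  nlinarith [Real.pi_gt_three, Nat.cast_nonneg (α := ℝ) n]

lemma choose_lower (n m : ℕ) (hm : m < n) (hn : 3 ≤ n) :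
    Real.exp (-4) * (((n : ℝ) ^ 2 / 2) ^ m / m.factorial) ≤ ((n.choose 2).choose m : ℝ) := by
  have hN : ((n.choose 2 : ℕ) : ℝ) = n * (n - 1) / 2 := Nat.cast_choose_two ℝ n
  have hn' : (3 : ℝ) ≤ n := by exact_mod_cast hn
  have hm' : (m : ℝ) + 1 ≤ n := by exact_mod_cast hm
  have hle : m ≤ n.choose 2 + 1 := by
    have : (m : ℝ) ≤ (n.choose 2 : ℕ) + 1 := by rw [hN]; nlinarith
    exact_mod_cast this
  have h1 : (((n.choose 2 + 1 - m) ^ m : ℕ) : ℝ) ≤ ((n.choose 2).descFactorial m : ℕ) := by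
    exact_mod_cast Nat.pow_sub_le_descFactorial (n.choose 2) m
  rw [Nat.descFactorial_eq_factorial_mul_choose] at h1
  push_cast [Nat.cast_sub hle] at h1
  rw [hN] at h1
  have hpos : (0 : ℝ) < m.factorial := by positivity
  rw [← mul_div_assoc, div_le_iff₀ hpos, mul_comm (((n.choose 2).choose m : ℕ) : ℝ)]
  refine le_trans ?_ h1
  have h2 : Real.exp (-4) ≤ Real.exp (-(4 / n)) ^ m := by
    rw [← Real.exp_nat_mul]
    apply Real.exp_le_exp.2
    have : (m : ℝ) * (4 / n) ≤ 4 := by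
      rw [← mul_div_assoc, div_le_iff₀ (by linarith)]; linarith
    linarith
  have h3 : Real.exp (-(4 / n)) * ((n : ℝ) ^ 2 / 2) ≤ n * (n - 1) / 2 + 1 - m := by
    have h4 : Real.exp (-(4 / n : ℝ)) ≤ n / (n + 4) := by
      rw [Real.exp_neg, inv_le_comm₀ (Real.exp_pos _) (by positivity)]
      have := Real.add_one_le_exp (4 / n : ℝ)
      refine le_trans (le_of_eq ?_) this
      field_simp
      ring
    have h5 : (n : ℝ) / (n + 4) * ((n : ℝ) ^ 2 / 2) ≤ n * (n - 1) / 2 + 1 - m := by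
      rw [div_mul_eq_mul_div, div_le_iff₀ (by linarith)]
      nlinarith [sq_nonneg ((n : ℝ) - 4)]
    refine le_trans ?_ h5
    gcongr
  calc _ ≤ Real.exp (-(4 / n)) ^ m * ((n : ℝ) ^ 2 / 2) ^ m := by gcongr
    _ = (Real.exp (-(4 / n)) * ((n : ℝ) ^ 2 / 2)) ^ m := by rw [mul_pow]
    _ ≤ _ := by gcongr

lemma final_bound (r s n m : ℕ) (hr : 1 ≤ r) (hs : 1 ≤ s) (hm : m = r + s) (hn : n = 2 * r + s) :
    (n.factorial : ℝ) * Real.exp 1 ^ n * ((1 / 2) ^ r / r.factorial) ≤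
      Real.exp 6 * Real.exp 4 * ((2 / Real.exp 1) ^ s) * ((m : ℝ) ^ m * √m) * (√n / (n : ℝ) ^ s) *
        (1 / ((r : ℝ) ^ r * √r)) * ((n.choose 2).choose m : ℝ) := by
  have hC := choose_lower n m (by omega) (by omega)
  have hU := fact_upper n (by omega)
  have hUm := fact_upper m (by omega)
  have hL := fact_lower r
  have hn0 : (0 : ℝ) < n := by exact_mod_cast (by omega : 0 < n)
  have hm0 : (0 : ℝ) < m := by exact_mod_cast (by omega : 0 < m)
  have hr0 : (0 : ℝ) < r := by exact_mod_cast (by omega : 0 < r)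
  have sn : 0 < √(n : ℝ) := Real.sqrt_pos.2 hn0
  have sm : 0 < √(m : ℝ) := Real.sqrt_pos.2 hm0
  have sr : 0 < √(r : ℝ) := Real.sqrt_pos.2 hr0
  have hE : 0 < Real.exp 1 := Real.exp_pos 1
  calc (n.factorial : ℝ) * Real.exp 1 ^ n * ((1 / 2) ^ r / r.factorial)
      ≤ (Real.exp 1 * √n * (n ^ n / Real.exp 1 ^ n)) * Real.exp 1 ^ n *
        ((1 / 2) ^ r / (√r * (r ^ r / Real.exp 1 ^ r))) := by gcongr
    _ ≤ Real.exp 6 * Real.exp 4 * ((2 / Real.exp 1) ^ s) * ((m : ℝ) ^ m * √m) *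
        (√n / (n : ℝ) ^ s) * (1 / ((r : ℝ) ^ r * √r)) * (Real.exp (-4) * (((n : ℝ) ^ 2 / 2) ^ m /
          (Real.exp 1 * √m * (m ^ m / Real.exp 1 ^ m)))) := by
        have e6 : Real.exp 6 = Real.exp 4 * Real.exp 1 * Real.exp 1 := by
          rw [← Real.exp_add, ← Real.exp_add]; norm_num
        have e4 : Real.exp (-4) = (Real.exp 4)⁻¹ := Real.exp_neg 4
        have h4 : (1 : ℝ) ≤ Real.exp 4 := Real.one_le_exp (by norm_num)
        have : Real.exp 6 * Real.exp 4 * ((2 / Real.exp 1) ^ s) * ((m : ℝ) ^ m * √m) *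
          (√n / (n : ℝ) ^ s) * (1 / ((r : ℝ) ^ r * √r)) * (Real.exp (-4) * (((n : ℝ) ^ 2 / 2) ^ m /
          (Real.exp 1 * √m * (m ^ m / Real.exp 1 ^ m)))) =
          Real.exp 4 * ((Real.exp 1 * √n * (n ^ n / Real.exp 1 ^ n)) * Real.exp 1 ^ n *
          ((1 / 2) ^ r / (√r * (r ^ r / Real.exp 1 ^ r)))) := by
          rw [e6, e4]
          have hnm : ((n : ℝ) ^ 2 / 2) ^ m = (n : ℝ) ^ n * (n : ℝ) ^ s / (2 ^ r * 2 ^ s) := by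
            rw [div_pow, ← pow_mul, ← pow_add, ← pow_add, ← hm]
            congr 2
            omega
          have hem : Real.exp 1 ^ m = Real.exp 1 ^ r * Real.exp 1 ^ s := by
            rw [← pow_add, hm]
          rw [hnm, hem, div_pow, div_pow, one_pow]
          have h40 : Real.exp 4 ≠ 0 := (Real.exp_pos 4).ne'
          have hmm : (m : ℝ) ^ m ≠ 0 := by positivity
          generalize Real.exp 4 = E4 at *
          field_simp
        rw [this]
        refine le_mul_of_one_le_left (by positivity) h4
    _ ≤ _ := by
        gcongr
        refine le_trans ?_ hC
        gcongr

end PartFive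

theorem stmt3 :
    ∃ c : ℝ, 0 < c ∧ ∀ n m : ℕ, n < 2 * m → m < n →
      (Ucard n m : ℝ) ≤
        c * (2 / Real.exp 1) ^ ((2 * m : ℝ) - n) * (m : ℝ) ^ ((m : ℝ) + 1 / 2)
          * (n : ℝ) ^ ((n : ℝ) - 2 * m + 1 / 2) * ((n : ℝ) - m) ^ (-((n : ℝ) - m + 1 / 2))
          * ((n.choose 2).choose m : ℝ) := by
  refine ⟨Real.exp 6 * Real.exp 4, by positivity, ?_⟩
  intro n m h1 h2
  obtain ⟨r, hr⟩ : ∃ r, n = m + r := ⟨n - m, by omega⟩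
  obtain ⟨s, hs⟩ : ∃ s, m = r + s := ⟨m - r, by omega⟩
  have hU : (Ucard n m : ℝ) ≤ pc (Fin n) r := by
    have := Ucard_le n m h2.le
    rw [show n - m = r by omega] at this
    exact_mod_cast this
  refine hU.trans ((P_bound r n).trans ?_)
  refine (final_bound r s n m (by omega) (by omega) hs (by omega)).trans (le_of_eq ?_)
  have hn0 : (0 : ℝ) < n := by exact_mod_cast (by omega : 0 < n)
  have hm0 : (0 : ℝ) < m := by exact_mod_cast (by omega : 0 < m)
  have hr0 : (0 : ℝ) < r := by exact_mod_cast (by omega : 0 < r)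
  have e1 : (2 * m : ℝ) - n = (s : ℝ) := by rw [hr, hs]; push_cast; ring
  have e2 : (n : ℝ) - 2 * m + 1 / 2 = 1 / 2 - (s : ℝ) := by rw [hr, hs]; push_cast; ring
  have e3 : (n : ℝ) - m = r := by rw [hr]; push_cast; ring
  rw [e1, e2, e3, Real.rpow_natCast, Real.rpow_add hm0, Real.rpow_sub hn0, Real.rpow_neg hr0.le,
    Real.rpow_add hr0, Real.rpow_natCast, Real.rpow_natCast, Real.rpow_natCast,
    ← Real.sqrt_eq_rpow, ← Real.sqrt_eq_rpow, ← Real.sqrt_eq_rpow, one_div]
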